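/- Let r ≥ 3 and ℓ ≥ (9r+8)/2. If G is a graph on 4ℓ vertices containing a spanning copy of M_{2ℓ}, then G has a fractional K_r-decomposition. -/

import Mathlib

open Finset
open scoped Classical

noncomputable def fracCliqueDecomp {V : Type*} [Fintype V] (G : SimpleGraph V) (r : ℕ) : Prop :=
  ∃ w : Finset V → ℝ, (∀ s, 0 ≤ w s) ∧
    ∀ u v : V, G.Adj u v →
      ∑ s ∈ univ.filter (fun s : Finset V => G.IsNClique r s ∧ u ∈ s ∧ v ∈ s), w s = 1

/-- The graph `M_k` on vertices `{a_1,b_1,…,a_k,b_k}` (encoded as `Fin k × Fin 2`):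
all edges between the pairs `{a_i,b_i}` and `{a_j,b_j}` whenever `|i - j| ≥ 2`,
and no other edges. -/
def Mgraph (k : ℕ) : SimpleGraph (Fin k × Fin 2) :=
  SimpleGraph.fromRel (fun u v => 2 ≤ |((u.1 : ℤ) - (v.1 : ℤ))|)

namespace FD

def cert : List (ℕ × ℕ × ℕ × List ℕ) := [
  (1001222,2,0,[0,0,3,4,0,0,0,1]), (1001222,1,2,[1,0,0,0,3,4,0,0]),
  (10135546,2,0,[4,0,0,0,0,0,0,1]), (10135546,1,2,[1,0,0,0,0,0,0,3]),
  (5826808,0,2,[0,1,0,0,0,0,0,0]), (5826808,2,1,[0,0,0,0,0,0,1,0]),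
  (8536250,2,1,[0,1,0,0,0,0,0,0]), (8536250,0,2,[0,0,0,0,0,0,1,0]),
  (2473018,2,1,[0,1,0,2,0,0,0,0]), (2473018,0,2,[0,0,0,0,2,0,1,0]),
  (1324560,0,2,[0,0,0,3,4,0,1,0]), (1324560,2,1,[0,1,0,3,4,0,0,0]),
  (9946552,2,2,[0,1,0,3,4,0,1,0]), (2647190,1,1,[3,4,0,0,0,0,1,0]),
  (2647190,0,0,[0,1,0,0,0,0,3,4]), (2655926,2,2,[4,0,0,0,0,0,1,0]),
  (2655926,2,2,[0,1,0,0,0,0,0,3]), (3751504,1,0,[0,0,1,0,0,0,0,0]),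
  (3751504,1,0,[0,0,0,0,0,1,0,0]), (1000038,2,0,[0,0,1,0,0,0,0,0]),
  (1000038,1,2,[0,0,0,0,0,1,0,0]), (12067511,2,1,[4,0,0,0,0,1,0,0]),
  (12067511,0,2,[0,0,1,0,0,0,0,3]), (4509290,2,0,[4,0,0,0,0,1,0,0]),
  (4509290,1,2,[0,0,1,0,0,0,0,3]), (6190920,0,1,[0,0,0,1,0,0,0,0]),
  (6190920,0,1,[0,0,0,0,1,0,0,0]), (563558,2,0,[0,0,0,1,0,0,0,0]),
  (563558,1,2,[0,0,0,0,1,0,0,0]), (218913,2,1,[4,0,2,0,1,0,0,0]),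
  (218913,0,2,[0,0,0,1,0,2,0,3]), (3215495,2,2,[4,0,0,0,1,0,0,0]),
  (3215495,2,2,[0,0,0,1,0,0,0,3]), (2528237,2,1,[4,0,0,1,0,0,0,0]),
  (2528237,0,2,[0,0,0,0,1,0,0,3]), (11744573,2,2,[4,0,0,1,0,0,0,0]),
  (11744573,2,2,[0,0,0,0,1,0,0,3]), (506132,2,1,[4,0,1,0,0,0,0,0]),
  (506132,0,2,[0,0,0,0,0,1,0,3]), (2362384,1,1,[2,0,1,0,1,0,2,0]),
  (2362384,0,0,[0,2,0,1,0,1,0,2]), (2956014,1,2,[2,0,1,0,1,0,2,0]),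
  (2956014,2,0,[0,2,0,1,0,1,0,2]), (128990,2,0,[4,0,0,1,0,0,0,2]),
  (128990,1,2,[2,0,0,0,1,0,0,3]), (1371648,1,1,[2,0,2,0,2,0,0,0]),
  (1371648,0,0,[0,0,0,2,0,2,0,2]), (1630018,2,0,[4,0,3,4,0,2,0,2]),
  (1630018,1,2,[2,0,2,0,3,4,0,3]), (2687714,0,0,[0,3,4,0,3,4,0,2]),
  (2687714,1,1,[2,0,3,4,0,3,4,0]), (1112270,2,2,[4,0,0,3,4,0,2,0]),
  (1112270,2,2,[0,2,0,3,4,0,0,3]), (4706100,2,1,[0,3,4,0,0,0,2,0]),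
  (4706100,0,2,[0,2,0,0,0,3,4,0]), (4253337,2,1,[4,0,1,0,2,0,0,0]),
  (4253337,0,2,[0,0,0,2,0,1,0,3]), (1083474,1,2,[3,4,0,0,2,0,0,0]),
  (1083474,2,0,[0,0,0,2,0,0,3,4]), (3501220,1,2,[3,4,0,1,0,0,0,3]),
  (3501220,2,0,[4,0,0,0,1,0,3,4]), (1955291,1,2,[3,4,0,2,0,0,0,3]),
  (1955291,2,0,[4,0,0,0,2,0,3,4]), (7916189,1,2,[3,4,0,0,0,2,0,3]),
  (7916189,2,0,[4,0,2,0,0,0,3,4]), (7478166,1,1,[3,4,0,3,4,0,0,0]),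
  (7478166,0,0,[0,0,0,3,4,0,3,4]), (14770528,1,0,[3,4,0,3,4,0,3,4]),
  (2735002,1,2,[3,4,0,0,3,4,0,0]), (2735002,2,0,[0,0,3,4,0,0,3,4]),
  (2460012,1,2,[3,4,0,0,0,3,4,0]), (2460012,2,0,[0,3,4,0,0,0,3,4]),
  (5726434,0,0,[0,3,4,0,3,4,0,0]), (5726434,1,1,[0,0,3,4,0,3,4,0]),
  (4945848,0,1,[0,3,4,0,3,4,0,0]), (4945848,0,1,[0,0,3,4,0,3,4,0]),
  (2971208,2,0,[0,3,4,0,3,4,0,0]), (2971208,1,2,[0,0,3,4,0,3,4,0]),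
  (1834420,2,2,[0,3,4,0,3,4,0,0]), (1834420,2,2,[0,0,3,4,0,3,4,0]),
  (19011112,2,2,[0,3,4,0,3,4,0,3]), (19011112,2,2,[4,0,3,4,0,3,4,0]),
  (102112,2,1,[0,3,4,0,0,3,4,0]), (102112,0,2,[0,3,4,0,0,3,4,0]),
  (2004094,0,2,[0,0,3,4,0,1,0,3]), (2004094,2,1,[4,0,1,0,3,4,0,0])]

def psi2 (n : ℕ) : ℕ := if n = 1 then 2 else if n = 2 then 2 else if n = 3 then 1 else if n = 4 then 1 else 0

def sc (n : ℕ) : ℕ := if n = 1 then 2 else if n = 2 then 1 else if n = 3 then 1 else 0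

def ps (y : ℕ) : ℕ := if y = 2 then 2 else 1

def rL (x : ℕ × ℕ × ℕ × List ℕ) : ℕ := x.2.1
def rR (x : ℕ × ℕ × ℕ × List ℕ) : ℕ := x.2.2.1
def rS (x : ℕ × ℕ × ℕ × List ℕ) (p : ℕ) : ℕ := x.2.2.2.getD p 0

def csum (h : ℕ × ℕ × ℕ × List ℕ → ℕ) : ℕ := (cert.map (fun x => x.1 * h x)).sum

def dd : ℕ := 356376576

def ind (p : Bool) : ℕ := if p then 1 else 0

set_option maxRecDepth 100000

theorem c_lr : ∀ y < 3, ∀ z < 3, 16 * csum (fun x => ind (rL x == y) * ind (rR x == z)) = dd * (ps y * ps z) := by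
  decide +kernel

theorem c_sl : ∀ p < 7, ∀ y < 3, 32 * csum (fun x => psi2 (rS x (p+1)) * ind (rL x == y)) = 4 * dd * ps y := by
  decide +kernel

theorem c_sr : ∀ p < 7, ∀ y < 3, 32 * csum (fun x => psi2 (rS x p) * ind (rR x == y)) = 4 * dd * ps y := by
  decide +kernel

theorem c_s : ∀ p < 8, 2 * csum (fun x => psi2 (rS x p)) = dd := by
  decide +kernel

theorem c_pair : ∀ p < 8, ∀ p' < 8, p + 2 ≤ p' → 4 * csum (fun x => psi2 (rS x p) * psi2 (rS x p')) = dd := by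
  decide +kernel

theorem c_b : ∀ p < 7, 8 * csum (fun x => ind (rS x p == 3) * ind (rS x (p+1) == 4)) = dd := by
  decide +kernel

theorem c_w : ∀ p < 8, 32 * csum (fun x => ind (rS x p == 2)) = dd := by
  decide +kernel

theorem c_ls : 4 * csum (fun x => ind (rS x 0 == 4) * ind (rL x == 2)) = dd := by
  decide +kernel

theorem c_rs : 4 * csum (fun x => ind (rS x 7 == 3) * ind (rR x == 2)) = dd := by
  decide +kernel

theorem c_valid : ∀ x ∈ cert, rL x < 3 ∧ rR x < 3 ∧ (rL x = 0 → rS x 0 = 0) ∧ (rL x = 2 → rS x 0 = 0 ∨ rS x 0 = 4) ∧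
    (rR x = 1 → rS x 7 = 0) ∧ (rR x = 2 → rS x 7 = 0 ∨ rS x 7 = 3) ∧
    (∀ p < 7, rS x p ≠ 0 → rS x (p+1) ≠ 0 → rS x p = 3 ∧ rS x (p+1) = 4) ∧
    x.2.2.2.length = 8 ∧ 2 ≤ ((List.range 8).map (fun p => sc (rS x p))).sum := by
  decide +kernel

noncomputable def psi (n : ℕ) : ℝ := (psi2 n : ℝ) / 2
noncomputable def pii (y : ℕ) : ℝ := (ps y : ℝ) / 4
noncomputable def one (p : Prop) : ℝ := if p then 1 else 0

theorem pii_pos (y : ℕ) : 0 < pii y := by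
  unfold pii ps; split_ifs <;> norm_num

structure Loc (Λ : Type) [Fintype Λ] (q : Λ → ℝ) (l r : Λ → ℕ) (s : Λ → ℕ → ℕ) : Prop where
  q0 : ∀ k, 0 ≤ q k
  lr : ∀ y < 3, ∀ z < 3, ∑ k, q k * one (r k = z) * one (l k = y) = pii y * pii z
  sl : ∀ p < 7, ∀ y < 3, ∑ k, q k * psi (s k (p+1)) * one (l k = y) = 1/4 * pii y
  sr : ∀ p < 7, ∀ y < 3, ∑ k, q k * psi (s k p) * one (r k = y) = 1/4 * pii y
  s1 : ∀ p < 8, ∑ k, q k * psi (s k p) = 1/4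
  pair : ∀ p < 8, ∀ p' < 8, p + 2 ≤ p' → ∑ k, q k * (psi (s k p) * psi (s k p')) = 1/16
  b : ∀ p < 7, ∑ k, q k * (one (s k p = 3) * one (s k (p+1) = 4)) = 1/8
  w : ∀ p < 8, ∑ k, q k * one (s k p = 2) = 1/32
  ls : ∑ k, q k * one (s k 0 = 4) * one (l k = 2) = 1/4
  rs : ∑ k, q k * one (s k 7 = 3) * one (r k = 2) = 1/4
  l3 : ∀ k, l k < 3
  r3 : ∀ k, r k < 3
  l0 : ∀ k, l k = 0 → s k 0 = 0
  l2 : ∀ k, l k = 2 → s k 0 = 0 ∨ s k 0 = 4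
  r1 : ∀ k, r k = 1 → s k 7 = 0
  r2 : ∀ k, r k = 2 → s k 7 = 0 ∨ s k 7 = 3
  valid : ∀ k, ∀ p < 7, s k p ≠ 0 → s k (p+1) ≠ 0 → s k p = 3 ∧ s k (p+1) = 4
  zero : ∀ k, ∀ p, 8 ≤ p → s k p = 0
  score : ∀ k, 2 ≤ ∑ p ∈ range 8, sc (s k p)

theorem lsum_real (c : List (ℕ × ℕ × ℕ × List ℕ)) (h : ℕ × ℕ × ℕ × List ℕ → ℕ) :
    ∑ k : Fin c.length, ((c.get k).1 : ℝ) * (h (c.get k) : ℝ) = ((c.map (fun x => x.1 * h x)).sum : ℝ) := by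
  rw [← List.sum_ofFn (f := fun k : Fin c.length => ((c.get k).1 : ℝ) * (h (c.get k) : ℝ))]
  have : (List.ofFn fun k : Fin c.length => ((c.get k).1 : ℝ) * (h (c.get k) : ℝ))
      = c.map (fun x => (x.1 : ℝ) * (h x : ℝ)) := by
    conv_rhs => rw [← List.ofFn_get c, List.map_ofFn]
    rfl
  rw [this, Nat.cast_list_sum, List.map_map]
  congr 1
  refine List.map_congr_left fun x _ => ?_
  simp

theorem lsum_real' (c' : List (ℕ × ℕ × ℕ × List ℕ)) (d : ℕ) (hd0 : 0 < d)
    (h : ℕ × ℕ × ℕ × List ℕ → ℕ) (H : Fin c'.length → ℝ) (a b : ℕ) (t : ℝ) (c : ℝ)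
    (h1 : a * (c'.map (fun x => x.1 * h x)).sum = d * b) (ha : 0 < a)
    (hH : ∀ k, H k = (h (c'.get k) : ℝ) * t) (hc : c * a = b * t) :
    ∑ k : Fin c'.length, ((c'.get k).1 : ℝ) / d * H k = c := by
  have h2 : (a : ℝ) * (((c'.map (fun x => x.1 * h x)).sum : ℕ) : ℝ) = d * b := by exact_mod_cast h1
  rw [← lsum_real] at h2
  have hd : (d : ℝ) ≠ 0 := by positivity
  have ha' : (a : ℝ) ≠ 0 := by positivity
  have : ∑ k : Fin c'.length, ((c'.get k).1 : ℝ) / d * H k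
     = (∑ k : Fin c'.length, ((c'.get k).1 : ℝ) * (h (c'.get k) : ℝ)) * (t / d) := by
    rw [Finset.sum_mul]
    refine Finset.sum_congr rfl fun k _ => ?_
    rw [hH]; ring
  rw [this]
  field_simp
  apply mul_left_cancel₀ ha'
  calc _ = (a * ∑ k : Fin c'.length, ((c'.get k).1 : ℝ) * (h (c'.get k) : ℝ)) * t := by ring
    _ = _ := by rw [h2]; linear_combination (- (d:ℝ)) * hc

theorem dd_pos : 0 < dd := by decide +kernel

theorem csum_real' (h : ℕ × ℕ × ℕ × List ℕ → ℕ) (H : Fin cert.length → ℝ) (a b : ℕ) (t : ℝ) (c : ℝ)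
    (h1 : a * csum h = dd * b) (ha : 0 < a) (hH : ∀ k, H k = (h (cert.get k) : ℝ) * t) (hc : c * a = b * t) :
    ∑ k : Fin cert.length, ((cert.get k).1 : ℝ) / dd * H k = c :=
  lsum_real' cert dd dd_pos h H a b t c h1 ha hH hc

attribute [irreducible] cert dd

theorem one_ind (a b : ℕ) : one (a = b) = ((ind (a == b) : ℕ) : ℝ) := by
  unfold one ind; by_cases h : a = b <;> simp [h]

theorem loc_cert : Loc (Fin cert.length) (fun k => ((cert.get k).1 : ℝ) / dd)
    (fun k => rL (cert.get k)) (fun k => rR (cert.get k)) (fun k => rS (cert.get k)) where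
  q0 k := by positivity
  lr y hy z hz := by
    have := csum_real' _ (fun k => one (rR (cert.get k) = z) * one (rL (cert.get k) = y)) 16 (ps y * ps z) 1
      (pii y * pii z) (c_lr y hy z hz) (by norm_num) (by intro k; simp only [one_ind]; push_cast; ring)
      (by unfold pii; push_cast; ring)
    simpa only [mul_assoc] using this
  sl p hp y hy := by
    have := csum_real' _ (fun k => psi (rS (cert.get k) (p+1)) * one (rL (cert.get k) = y)) 32 (4 * ps y) (1/2)
      (1/4 * pii y) ((c_sl p hp y hy).trans (by ring)) (by norm_num)
      (by intro k; simp only [one_ind, psi]; push_cast; ring)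
      (by unfold pii; push_cast; ring)
    simpa only [mul_assoc] using this
  sr p hp y hy := by
    have := csum_real' _ (fun k => psi (rS (cert.get k) p) * one (rR (cert.get k) = y)) 32 (4 * ps y) (1/2)
      (1/4 * pii y) ((c_sr p hp y hy).trans (by ring)) (by norm_num)
      (by intro k; simp only [one_ind, psi]; push_cast; ring)
      (by unfold pii; push_cast; ring)
    simpa only [mul_assoc] using this
  s1 p hp := csum_real' _ (fun k => psi (rS (cert.get k) p)) 2 1 (1/2)
      (1/4) ((c_s p hp).trans (by ring)) (by norm_num)
      (by intro k; simp only [psi]; push_cast; ring) (by norm_num)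
  pair p hp p' hp' h := csum_real' _ (fun k => psi (rS (cert.get k) p) * psi (rS (cert.get k) p')) 4 1 (1/4)
      (1/16) ((c_pair p hp p' hp' h).trans (by ring)) (by norm_num)
      (by intro k; simp only [psi]; push_cast; ring) (by norm_num)
  b p hp := csum_real' _ (fun k => one (rS (cert.get k) p = 3) * one (rS (cert.get k) (p+1) = 4)) 8 1 1
      (1/8) ((c_b p hp).trans (by ring)) (by norm_num)
      (by intro k; simp only [one_ind]; push_cast; ring) (by norm_num)
  w p hp := csum_real' _ (fun k => one (rS (cert.get k) p = 2)) 32 1 1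
      (1/32) ((c_w p hp).trans (by ring)) (by norm_num)
      (by intro k; simp only [one_ind]; push_cast; ring) (by norm_num)
  ls := by
    have := csum_real' _ (fun k => one (rS (cert.get k) 0 = 4) * one (rL (cert.get k) = 2)) 4 1 1
      (1/4) (c_ls.trans (by ring)) (by norm_num)
      (by intro k; simp only [one_ind]; push_cast; ring) (by norm_num)
    simpa only [mul_assoc] using this
  rs := by
    have := csum_real' _ (fun k => one (rS (cert.get k) 7 = 3) * one (rR (cert.get k) = 2)) 4 1 1
      (1/4) (c_rs.trans (by ring)) (by norm_num)
      (by intro k; simp only [one_ind]; push_cast; ring) (by norm_num)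
    simpa only [mul_assoc] using this
  l3 k := (c_valid _ (List.get_mem _ k)).1
  r3 k := (c_valid _ (List.get_mem _ k)).2.1
  l0 k := (c_valid _ (List.get_mem _ k)).2.2.1
  l2 k := (c_valid _ (List.get_mem _ k)).2.2.2.1
  r1 k := (c_valid _ (List.get_mem _ k)).2.2.2.2.1
  r2 k := (c_valid _ (List.get_mem _ k)).2.2.2.2.2.1
  valid k := (c_valid _ (List.get_mem _ k)).2.2.2.2.2.2.1
  zero k p hp := by
    have := (c_valid _ (List.get_mem _ k)).2.2.2.2.2.2.2.1
    unfold rS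
    rw [List.getD_eq_default]
    omega
  score k := by
    have := (c_valid _ (List.get_mem _ k)).2.2.2.2.2.2.2.2
    simpa [List.range_succ, Finset.sum_range_succ, add_assoc] using this

structure Fam (L : ℕ) (Ω : Type) [Fintype Ω] (w : Ω → ℝ) (st : Ω → ℕ → ℕ) (Y : Ω → ℕ) : Prop where
  w0 : ∀ ω, 0 ≤ w ω
  Y3 : ∀ ω, Y ω < 3
  law : ∀ y < 3, ∑ ω, w ω * one (Y ω = y) = pii y
  single : ∀ i, i + 1 < 8 * L → ∀ y < 3, ∑ ω, w ω * psi (st ω i) * one (Y ω = y) = 1/4 * pii y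
  last : ∀ i, i + 1 = 8 * L → ∑ ω, w ω * psi (st ω i) = 1/4
  last1 : ∀ i, i + 1 = 8 * L → ∀ ω, Y ω = 1 → st ω i = 0
  last2 : ∀ i, i + 1 = 8 * L → ∀ ω, Y ω = 2 → st ω i = 0 ∨ st ω i = 3
  rs : ∀ i, i + 1 = 8 * L → ∑ ω, w ω * one (st ω i = 3) * one (Y ω = 2) = 1/4
  pair : ∀ i j, i + 2 ≤ j → j < 8 * L → ∑ ω, w ω * (psi (st ω i) * psi (st ω j)) = 1/16
  b : ∀ i, i + 1 < 8 * L → ∑ ω, w ω * (one (st ω i = 3) * one (st ω (i+1) = 4)) = 1/8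
  ws : ∀ i, i < 8 * L → ∑ ω, w ω * one (st ω i = 2) = 1/32
  valid : ∀ ω, w ω ≠ 0 → ∀ i, i + 1 < 8 * L → st ω i ≠ 0 → st ω (i+1) ≠ 0 → st ω i = 3 ∧ st ω (i+1) = 4
  score : ∀ ω, ∀ k < L, 2 ≤ ∑ p ∈ range 8, sc (st ω (8 * k + p))

theorem fam_zero : Fam 0 (Fin 3) (fun y => pii y) (fun _ _ => 0) (fun y => y) where
  w0 y := (pii_pos _).le
  Y3 y := y.2
  law y hy := by
    rw [Finset.sum_eq_single (⟨y, hy⟩ : Fin 3)]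
    · simp [one]
    · intro b _ hb
      have : (b : ℕ) ≠ y := fun h => hb (Fin.ext h)
      simp [one, this]
    · simp
  single i h := by omega
  last i h := by omega
  last1 i h := by omega
  last2 i h := by omega
  rs i h := by omega
  pair i j h h' := by omega
  b i h := by omega
  ws i h := by omega
  valid ω _ i h := by omega
  score ω k h := by omega

theorem sum_one {Ω : Type} [Fintype Ω] (Y : Ω → ℕ) (hY : ∀ ω, Y ω < 3) (g : Ω → ℝ) :
    ∑ ω, g ω = ∑ y ∈ range 3, ∑ ω, g ω * one (Y ω = y) := by
  rw [Finset.sum_comm]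
  refine Finset.sum_congr rfl fun ω _ => ?_
  rw [← Finset.mul_sum]
  have : ∑ y ∈ range 3, one (Y ω = y) = 1 := by
    rw [Finset.sum_eq_single (Y ω)]
    · simp [one]
    · intro y _ hy; simp [one, hy.symm]
    · intro hh; exact absurd (Finset.mem_range.2 (hY ω)) hh
  rw [this, mul_one]

noncomputable def nw {Ω Λ : Type} (w : Ω → ℝ) (Y : Ω → ℕ) (q : Λ → ℝ) (l : Λ → ℕ) (x : Ω × Λ) : ℝ :=
  w x.1 * q x.2 * (one (l x.2 = Y x.1) / pii (Y x.1))

theorem factor {Ω Λ : Type} [Fintype Ω] [Fintype Λ] (w : Ω → ℝ) (Y : Ω → ℕ) (q : Λ → ℝ) (l : Λ → ℕ)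
    (hY : ∀ ω, Y ω < 3) (g : Ω → ℝ) (h : Λ → ℝ) (F : Ω × Λ → ℝ) (hF : ∀ ω k, F (ω, k) = g ω * h k) :
    ∑ x : Ω × Λ, nw w Y q l x * F x =
      ∑ y ∈ range 3, (∑ ω, w ω * g ω * one (Y ω = y)) * (∑ k, q k * h k * one (l k = y)) / pii y := by
  have key : ∀ ω k, nw w Y q l (ω, k) * F (ω, k) =
      ∑ y ∈ range 3, (w ω * g ω * one (Y ω = y)) * (q k * h k * one (l k = y)) / pii y := by
    intro ω k
    rw [hF, Finset.sum_eq_single (Y ω)]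
    · simp only [nw, one]; split_ifs <;> simp; ring
    · intro y _ hy
      simp [one, hy.symm]
    · intro hh; exact absurd (Finset.mem_range.2 (hY ω)) hh
  rw [Fintype.sum_prod_type]
  simp only [key]
  have h2 : ∀ ω, ∑ k, ∑ y ∈ range 3, (w ω * g ω * one (Y ω = y)) * (q k * h k * one (l k = y)) / pii y
      = ∑ y ∈ range 3, (w ω * g ω * one (Y ω = y)) * (∑ k, q k * h k * one (l k = y)) / pii y := by
    intro ω
    rw [Finset.sum_comm]
    refine Finset.sum_congr rfl fun y _ => ?_
    rw [Finset.mul_sum, Finset.sum_div]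
  simp only [h2]
  rw [Finset.sum_comm]
  refine Finset.sum_congr rfl fun y _ => ?_
  rw [Finset.sum_mul, Finset.sum_div]

section step
variable {L : ℕ} {Ω Λ : Type} [Fintype Ω] [Fintype Λ] {w : Ω → ℝ} {st : Ω → ℕ → ℕ} {Y : Ω → ℕ}
  {q : Λ → ℝ} {l r : Λ → ℕ} {s : Λ → ℕ → ℕ}

theorem Loc.lmarg (HL : Loc Λ q l r s) (y : ℕ) (hy : y < 3) :
    ∑ k, q k * one (l k = y) = pii y := by
  rw [sum_one r HL.r3]
  have : ∀ z ∈ range 3, ∑ k, q k * one (l k = y) * one (r k = z) = pii y * pii z := by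
    intro z hz
    rw [← HL.lr y hy z (Finset.mem_range.1 hz)]
    exact Finset.sum_congr rfl fun k _ => by ring
  rw [Finset.sum_congr rfl this, ← Finset.mul_sum]
  norm_num [Finset.sum_range_succ, pii, ps]

/-- old-only events -/
theorem old_only (HF : Fam L Ω w st Y) (HL : Loc Λ q l r s) (g : Ω → ℝ) (F : Ω × Λ → ℝ)
    (hF : ∀ ω k, F (ω, k) = g ω) : ∑ x : Ω × Λ, nw w Y q l x * F x = ∑ ω, w ω * g ω := by
  rw [factor w Y q l HF.Y3 g (fun _ => 1) F (by simpa using hF), sum_one Y HF.Y3 (fun ω => w ω * g ω)]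
  refine Finset.sum_congr rfl fun y hy => ?_
  simp only [mul_one]
  rw [HL.lmarg y (Finset.mem_range.1 hy), mul_div_assoc, div_self (pii_pos y).ne', mul_one]

/-- new-only events -/
theorem new_only (HF : Fam L Ω w st Y) (HL : Loc Λ q l r s) (h : Λ → ℝ) (F : Ω × Λ → ℝ)
    (hF : ∀ ω k, F (ω, k) = h k) : ∑ x : Ω × Λ, nw w Y q l x * F x = ∑ k, q k * h k := by
  rw [factor w Y q l HF.Y3 (fun _ => 1) h F (by simpa using hF), sum_one l HL.l3 (fun k => q k * h k)]
  refine Finset.sum_congr rfl fun y hy => ?_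
  simp only [mul_one]
  rw [HF.law y (Finset.mem_range.1 hy), mul_comm, mul_div_assoc, div_self (pii_pos y).ne', mul_one]

/-- old event constant conditional mean -/
theorem mixed_old (HF : Fam L Ω w st Y) (HL : Loc Λ q l r s) (g : Ω → ℝ) (h : Λ → ℝ) (F : Ω × Λ → ℝ)
    (hF : ∀ ω k, F (ω, k) = g ω * h k) (c : ℝ) (hg : ∀ y < 3, ∑ ω, w ω * g ω * one (Y ω = y) = c * pii y) :
    ∑ x : Ω × Λ, nw w Y q l x * F x = c * ∑ k, q k * h k := by
  rw [factor w Y q l HF.Y3 g h F hF, sum_one l HL.l3 (fun k => q k * h k), Finset.mul_sum]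
  refine Finset.sum_congr rfl fun y hy => ?_
  rw [hg y (Finset.mem_range.1 hy)]
  have := (pii_pos y).ne'
  field_simp

theorem mixed_new (HF : Fam L Ω w st Y) (HL : Loc Λ q l r s) (g : Ω → ℝ) (h : Λ → ℝ) (F : Ω × Λ → ℝ)
    (hF : ∀ ω k, F (ω, k) = g ω * h k) (c : ℝ) (hg : ∀ y < 3, ∑ k, q k * h k * one (l k = y) = c * pii y) :
    ∑ x : Ω × Λ, nw w Y q l x * F x = c * ∑ ω, w ω * g ω := by
  rw [factor w Y q l HF.Y3 g h F hF, sum_one Y HF.Y3 (fun ω => w ω * g ω), Finset.mul_sum]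
  refine Finset.sum_congr rfl fun y hy => ?_
  rw [hg y (Finset.mem_range.1 hy)]
  have := (pii_pos y).ne'
  field_simp

def nst (L : ℕ) (st : Ω → ℕ → ℕ) (s : Λ → ℕ → ℕ) (x : Ω × Λ) (i : ℕ) : ℕ :=
  if i < 8 * L then st x.1 i else s x.2 (i - 8 * L)

theorem nst_old (L : ℕ) (st : Ω → ℕ → ℕ) (s : Λ → ℕ → ℕ) (x : Ω × Λ) {i : ℕ} (h : i < 8 * L) :
    nst L st s x i = st x.1 i := by simp [nst, h]

theorem nst_new (L : ℕ) (st : Ω → ℕ → ℕ) (s : Λ → ℕ → ℕ) (x : Ω × Λ) (p : ℕ) :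
    nst L st s x (8 * L + p) = s x.2 p := by simp [nst]

theorem Loc.rmarg (HL : Loc Λ q l r s) (y : ℕ) (hy : y < 3) :
    ∑ k, q k * one (r k = y) = pii y := by
  rw [sum_one l HL.l3]
  have : ∀ z ∈ range 3, ∑ k, q k * one (r k = y) * one (l k = z) = pii z * pii y := by
    intro z hz
    exact HL.lr z (Finset.mem_range.1 hz) y hy
  rw [Finset.sum_congr rfl this, ← Finset.sum_mul]
  norm_num [Finset.sum_range_succ, pii, ps]

theorem Fam.tot (HF : Fam L Ω w st Y) (i : ℕ) (hi : i < 8 * L) : ∑ ω, w ω * psi (st ω i) = 1/4 := by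
  by_cases h : i + 1 = 8 * L
  · exact HF.last i h
  · rw [sum_one Y HF.Y3, Finset.sum_congr rfl (fun y hy => HF.single i (by omega) y (Finset.mem_range.1 hy))]
    norm_num [Finset.sum_range_succ, pii, ps]

theorem fam_step (HF : Fam L Ω w st Y) (HL : Loc Λ q l r s) :
    Fam (L+1) (Ω × Λ) (nw w Y q l) (nst L st s) (fun x => r x.2) where
  w0 x := by
    have := HF.w0 x.1; have := HL.q0 x.2; have := (pii_pos (Y x.1)).le
    have h1 : 0 ≤ one (l x.2 = Y x.1) := by unfold one; split_ifs <;> norm_num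
    unfold nw; positivity
  Y3 x := HL.r3 _
  law y hy := by
    rw [new_only HF HL (fun k => one (r k = y)) _ (fun _ _ => rfl)]
    exact HL.rmarg y hy
  single i hi y hy := by
    simp only [mul_assoc]
    rcases lt_or_ge i (8 * L) with h | h
    · rw [mixed_new HF HL (fun ω => psi (st ω i)) (fun k => one (r k = y)) _
        (fun ω k => by rw [nst_old _ _ _ _ h]) (pii y)
        (fun z hz => by rw [HL.lr z hz y hy]; ring), HF.tot i h]; ring
    · obtain ⟨p, rfl⟩ := Nat.exists_eq_add_of_le h
      rw [new_only HF HL (fun k => psi (s k p) * one (r k = y)) _ (fun ω k => by rw [nst_new])]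
      simp only [← mul_assoc]
      exact HL.sr p (by omega) y hy
  last i hi := by
    obtain rfl : i = 8 * L + 7 := by omega
    rw [new_only HF HL (fun k => psi (s k 7)) _ (fun ω k => by rw [nst_new])]
    exact HL.s1 7 (by omega)
  last1 i hi x hx := by
    obtain rfl : i = 8 * L + 7 := by omega
    rw [nst_new]; exact HL.r1 _ hx
  last2 i hi x hx := by
    obtain rfl : i = 8 * L + 7 := by omega
    rw [nst_new]; exact HL.r2 _ hx
  rs i hi := by
    obtain rfl : i = 8 * L + 7 := by omega
    simp only [mul_assoc]
    rw [new_only HF HL (fun k => one (s k 7 = 3) * one (r k = 2)) _ (fun ω k => by rw [nst_new])]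
    simp only [← mul_assoc]
    exact HL.rs
  pair i j hij hj := by
    rcases lt_or_ge j (8 * L) with h | h
    · rw [old_only HF HL (fun ω => psi (st ω i) * psi (st ω j)) _
        (fun ω k => by rw [nst_old _ _ _ _ h, nst_old _ _ _ _ (by omega)])]
      exact HF.pair i j hij h
    · obtain ⟨p, rfl⟩ := Nat.exists_eq_add_of_le h
      rcases lt_or_ge i (8 * L) with h' | h'
      · by_cases h1 : i + 1 = 8 * L
        · obtain ⟨p, rfl⟩ : ∃ p', p = p' + 1 := ⟨p - 1, by omega⟩
          rw [mixed_new HF HL (fun ω => psi (st ω i)) (fun k => psi (s k (p+1))) _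
            (fun ω k => by rw [nst_new, nst_old _ _ _ _ h']) (1/4)
            (fun y hy => HL.sl p (by omega) y hy), HF.tot i h']
          norm_num
        · rw [mixed_old HF HL (fun ω => psi (st ω i)) (fun k => psi (s k p)) _
            (fun ω k => by rw [nst_new, nst_old _ _ _ _ h']) (1/4)
            (fun y hy => HF.single i (by omega) y hy), HL.s1 p (by omega)]
          norm_num
      · obtain ⟨p', rfl⟩ := Nat.exists_eq_add_of_le h'
        rw [new_only HF HL (fun k => psi (s k p') * psi (s k p)) _ (fun ω k => by rw [nst_new, nst_new])]
        exact HL.pair p' (by omega) p (by omega) (by omega)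
  b i hi := by
    rcases lt_or_ge i (8 * L) with h | h
    · by_cases h1 : i + 1 = 8 * L
      · rw [factor w Y q l HF.Y3 (fun ω => one (st ω i = 3)) (fun k => one (s k 0 = 4)) _
          (fun ω k => by rw [nst_old _ _ _ _ h, show i + 1 = 8 * L + 0 from h1, nst_new])]
        have e0 : ∑ k, q k * one (s k 0 = 4) * one (l k = 0) = 0 := by
          refine Finset.sum_eq_zero fun k _ => ?_
          by_cases hk : l k = 0
          · have := HL.l0 k hk; simp [one, this]
          · simp [one, hk]
        have e1 : ∑ ω, w ω * one (st ω i = 3) * one (Y ω = 1) = 0 := by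
          refine Finset.sum_eq_zero fun k _ => ?_
          by_cases hk : Y k = 1
          · have := HF.last1 i h1 k hk; simp [one, this]
          · simp [one, hk]
        rw [Finset.sum_range_succ, Finset.sum_range_succ, Finset.sum_range_one, e0, e1, HL.ls, HF.rs i h1]
        norm_num [pii, ps]
      · rw [old_only HF HL (fun ω => one (st ω i = 3) * one (st ω (i+1) = 4)) _
          (fun ω k => by rw [nst_old _ _ _ _ h, nst_old _ _ _ _ (by omega)])]
        exact HF.b i (by omega)
    · obtain ⟨p, rfl⟩ := Nat.exists_eq_add_of_le h
      rw [new_only HF HL (fun k => one (s k p = 3) * one (s k (p+1) = 4)) _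
        (fun ω k => by rw [nst_new, add_assoc, nst_new])]
      exact HL.b p (by omega)
  ws i hi := by
    rcases lt_or_ge i (8 * L) with h | h
    · rw [old_only HF HL (fun ω => one (st ω i = 2)) _ (fun ω k => by rw [nst_old _ _ _ _ h])]
      exact HF.ws i h
    · obtain ⟨p, rfl⟩ := Nat.exists_eq_add_of_le h
      rw [new_only HF HL (fun k => one (s k p = 2)) _ (fun ω k => by rw [nst_new])]
      exact HL.w p (by omega)
  valid x hx i hi := by
    have hw : w x.1 ≠ 0 := fun h => hx (by simp [nw, h])
    have hl : l x.2 = Y x.1 := by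
      by_contra h; exact hx (by simp [nw, one, h])
    rcases lt_or_ge i (8 * L) with h | h
    · by_cases h1 : i + 1 = 8 * L
      · rw [nst_old _ _ _ _ h, show i + 1 = 8 * L + 0 from h1, nst_new]
        intro ha hb
        have hy := HF.Y3 x.1
        obtain h0 | h0 | h0 : Y x.1 = 0 ∨ Y x.1 = 1 ∨ Y x.1 = 2 := by omega
        · exact absurd (HL.l0 _ (hl.trans h0)) hb
        · exact absurd (HF.last1 i h1 _ h0) ha
        · have h2 := HL.l2 _ (hl.trans h0)
          have h3 := HF.last2 i h1 _ h0
          omega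
      · rw [nst_old _ _ _ _ h, nst_old _ _ _ _ (by omega)]
        exact HF.valid x.1 hw i (by omega)
    · obtain ⟨p, rfl⟩ := Nat.exists_eq_add_of_le h
      rw [nst_new, add_assoc, nst_new]
      exact HL.valid x.2 p (by omega)
  score x k hk := by
    rcases lt_or_ge k L with h | h
    · rw [Finset.sum_congr rfl (fun p hp => by
        rw [nst_old _ _ _ _ (by have := Finset.mem_range.1 hp; omega)])]
      exact HF.score x.1 k h
    · obtain rfl : k = L := by omega
      simp only [nst_new]
      exact HL.score x.2
end step

theorem fam_exists (L : ℕ) : ∃ (Ω : Type) (_ : Fintype Ω) (w : Ω → ℝ) (st : Ω → ℕ → ℕ) (Y : Ω → ℕ),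
    Fam L Ω w st Y := by
  induction L with
  | zero => exact ⟨_, _, _, _, _, fam_zero⟩
  | succ L ih =>
    obtain ⟨Ω, i1, w, st, Y, h⟩ := ih
    exact ⟨_, _, _, _, _, fam_step h loc_cert⟩

theorem card_sup {α : Type*} (S T : Finset α) (k : ℕ) (hT : T ⊆ S) (hk : T.card ≤ k)
    [DecidablePred (fun A : Finset α => T ⊆ A)] :
    ((powersetCard k S).filter (fun A => T ⊆ A)).card = (S.card - T.card).choose (k - T.card) := by
  rw [← Finset.card_sdiff_of_subset hT, ← Finset.card_powersetCard]
  refine Finset.card_nbij' (fun A => A \ T) (fun B => B ∪ T) ?_ ?_ ?_ ?_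
  · intro A hA
    simp only [coe_filter, mem_powersetCard, Set.mem_ofPred_eq, mem_coe] at hA ⊢
    refine ⟨Finset.sdiff_subset_sdiff hA.1.1 (le_refl _), ?_⟩
    rw [Finset.card_sdiff_of_subset hA.2, hA.1.2]
  · intro B hB
    simp only [coe_filter, mem_powersetCard, Set.mem_ofPred_eq, mem_coe] at hB ⊢
    refine ⟨⟨Finset.union_subset (hB.1.trans Finset.sdiff_subset) hT, ?_⟩, Finset.subset_union_right⟩
    rw [Finset.card_union_of_disjoint, hB.2]
    · omega
    · exact Finset.disjoint_of_subset_left hB.1 Finset.sdiff_disjoint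
  · intro A hA
    simp only [coe_filter, mem_powersetCard, Set.mem_ofPred_eq] at hA
    exact Finset.sdiff_union_of_subset hA.2
  · intro B hB
    simp only [mem_powersetCard, mem_coe] at hB
    simp only
    rw [Finset.union_sdiff_right, Finset.sdiff_eq_self_iff_disjoint]
    exact Finset.disjoint_of_subset_left hB.1 Finset.sdiff_disjoint

theorem one_nonneg (p : Prop) : 0 ≤ one p := by unfold one; split_ifs <;> norm_num

theorem sum_one_card {α : Type*} (S : Finset α) (P : α → Prop) [DecidablePred P] :
    ∑ s ∈ S, one (P s) = ((S.filter P).card : ℝ) := by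
  rw [Finset.card_filter]
  push_cast
  refine Finset.sum_congr rfl fun s _ => ?_
  unfold one; by_cases h : P s <;> simp [h]

theorem spread {V : Type*} [Fintype V] (G : SimpleGraph V) (r : ℕ) (hr : 2 ≤ r) {Ω : Type} (I : Finset Ω)
    (w : Ω → ℝ) (K : Ω → Finset V) (c : ℝ) (hc : 0 < c) (w0 : ∀ ω, 0 ≤ w ω)
    (hK : ∀ ω, w ω ≠ 0 → G.IsClique (K ω : Set V) ∧ r ≤ (K ω).card)
    (hE : ∀ u v, G.Adj u v → ∑ ω ∈ I, w ω * one (u ∈ K ω ∧ v ∈ K ω) = c) : fracCliqueDecomp G r := by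
  refine ⟨fun s => ∑ ω ∈ I, w ω / c / (((K ω).card - 2).choose (r - 2) : ℝ) * one (s ∈ powersetCard r (K ω)), ?_, ?_⟩
  · intro s
    refine Finset.sum_nonneg fun ω _ => ?_
    have := w0 ω; have := one_nonneg (s ∈ powersetCard r (K ω))
    positivity
  · intro u v huv
    rw [Finset.sum_comm]
    have : ∀ ω, ∑ s ∈ univ.filter (fun s : Finset V => G.IsNClique r s ∧ u ∈ s ∧ v ∈ s),
        w ω / c / (((K ω).card - 2).choose (r - 2) : ℝ) * one (s ∈ powersetCard r (K ω))
        = w ω * one (u ∈ K ω ∧ v ∈ K ω) * (1 / c) := by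
      intro ω
      by_cases hw : w ω = 0
      · simp [hw]
      obtain ⟨h1, h2⟩ := hK ω hw
      rw [← Finset.mul_sum]
      have h3 : ∑ s ∈ univ.filter (fun s : Finset V => G.IsNClique r s ∧ u ∈ s ∧ v ∈ s),
          one (s ∈ powersetCard r (K ω)) = (((powersetCard r (K ω)).filter (fun A => {u, v} ⊆ A)).card : ℝ) := by
        rw [sum_one_card]
        congr 2
        ext s
        simp only [mem_filter, mem_univ, true_and, mem_powersetCard, Finset.insert_subset_iff,
          Finset.singleton_subset_iff, SimpleGraph.isNClique_iff]
        constructor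
        · rintro ⟨⟨_, h⟩, h'⟩; exact ⟨h', h⟩
        · rintro ⟨h, h'⟩
          exact ⟨⟨⟨h1.subset (by exact_mod_cast h.1), h.2⟩, h'⟩, h⟩
      rw [h3]
      have hc2 : ({u, v} : Finset V).card = 2 := Finset.card_pair huv.ne
      by_cases huvK : u ∈ K ω ∧ v ∈ K ω
      · rw [card_sup _ _ _ (by simp [Finset.insert_subset_iff, huvK]) (by omega), hc2]
        have : (((K ω).card - 2).choose (r - 2) : ℝ) ≠ 0 := by
          have := Nat.choose_pos (show r - 2 ≤ (K ω).card - 2 by omega)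
          positivity
        simp only [one, huvK, and_self, if_true]
        field_simp
      · have : ((powersetCard r (K ω)).filter (fun A => {u, v} ⊆ A)) = ∅ := by
          refine Finset.filter_eq_empty_iff.2 fun A hA hs => huvK ?_
          have := hs.trans (mem_powersetCard.1 hA).1
          exact ⟨this (by simp), this (by simp)⟩
        rw [this]; simp [one, huvK]
    rw [Finset.sum_congr rfl (fun ω _ => this ω), ← Finset.sum_mul, hE u v huv]
    field_simp

structure Coin (S : Finset ℕ) (W : Finset ℕ → ℝ) : Prop where
  nn : ∀ A, 0 ≤ W A
  tot : ∑ A ∈ S.powerset, W A = 1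
  m1 : ∀ i ∈ S, ∑ A ∈ S.powerset, W A * one (i ∈ A) = 1/2
  m2 : ∀ i ∈ S, ∀ j ∈ S, i ≠ j → ∑ A ∈ S.powerset, W A * one (i ∈ A ∧ j ∈ A) = 1/4

theorem Coin.step {S : Finset ℕ} {W : Finset ℕ → ℝ} (H : Coin S W) (i : ℕ) (hi : i ∉ S) :
    Coin (insert i S) (fun A => W (A.erase i) / 2) := by
  have key : ∀ g : Finset ℕ → ℝ, ∑ A ∈ (insert i S).powerset, W (A.erase i) / 2 * g A
      = (∑ A ∈ S.powerset, W A * g A) / 2 + (∑ A ∈ S.powerset, W A * g (insert i A)) / 2 := by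
    intro g
    rw [Finset.sum_powerset_insert hi, Finset.sum_div, Finset.sum_div]
    congr 1
    · refine Finset.sum_congr rfl fun A hA => ?_
      have : i ∉ A := fun h => hi (mem_powerset.1 hA h)
      rw [Finset.erase_eq_of_notMem this]; ring
    · refine Finset.sum_congr rfl fun A hA => ?_
      have : i ∉ A := fun h => hi (mem_powerset.1 hA h)
      rw [Finset.erase_insert this]; ring
  have hno : ∀ g : Finset ℕ → ℝ, (∀ A, i ∉ A → g A = 0) → ∑ A ∈ S.powerset, W A * g A = 0 := by
    intro g hg
    refine Finset.sum_eq_zero fun A hA => ?_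
    have : i ∉ A := fun h => hi (mem_powerset.1 hA h)
    rw [hg A this, mul_zero]
  have M1 : ∀ j ∈ S, ∑ A ∈ (insert i S).powerset, W (A.erase i) / 2 * one (i ∈ A ∧ j ∈ A) = 1/4 := by
    intro j hj
    rw [key, hno _ (fun A hA => by simp [one, hA])]
    have hji : j ≠ i := fun h => hi (h ▸ hj)
    have : ∀ A : Finset ℕ, one (i ∈ insert i A ∧ j ∈ insert i A) = one (j ∈ A) := by
      intro A; simp [hji]
    simp only [this, H.m1 j hj]; norm_num
  refine ⟨fun A => by have := H.nn (A.erase i); positivity, ?_, ?_, ?_⟩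
  · have := key (fun _ => 1)
    simp only [mul_one, H.tot] at this
    rw [this]; norm_num
  · intro j hj
    rw [key]
    rcases Finset.mem_insert.1 hj with rfl | hj
    · rw [hno _ (fun A hA => by simp [one, hA])]
      have : ∀ A : Finset ℕ, one (j ∈ (insert j A : Finset ℕ)) = 1 := by intro A; simp [one]
      simp only [this, mul_one, H.tot]; norm_num
    · have hji : j ≠ i := fun h => hi (h ▸ hj)
      have : ∀ A : Finset ℕ, one (j ∈ insert i A) = one (j ∈ A) := by intro A; simp [hji]
      simp only [this, H.m1 j hj]; norm_num
  · intro j hj0 k hk hjk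
    rcases Finset.mem_insert.1 hj0 with rfl | hj
    · exact M1 k ((Finset.mem_insert.1 hk).resolve_left hjk.symm)
    rcases Finset.mem_insert.1 hk with hk | hk
    · subst hk
      have := M1 j hj
      simpa only [and_comm] using this
    · rw [key]
      have hji : j ≠ i := fun h => hi (h ▸ hj)
      have hki : k ≠ i := fun h => hi (h ▸ hk)
      have : ∀ A : Finset ℕ, one (j ∈ insert i A ∧ k ∈ insert i A) = one (j ∈ A ∧ k ∈ A) := by
        intro A; simp [hji, hki]
      simp only [this, H.m2 j hj k hk hjk]; norm_num

theorem coin_extend (F : Finset ℕ) (m : ℕ) (W : Finset ℕ → ℝ) (H : Coin F W)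
    (hb : ∀ A, W A ≠ 0 → m ≤ (F ∩ A).card) (S : Finset ℕ) (hFS : F ⊆ S) :
    ∃ W', Coin S W' ∧ ∀ A, W' A ≠ 0 → m ≤ (F ∩ A).card := by
  have main : ∀ T : Finset ℕ, Disjoint F T → ∃ W', Coin (F ∪ T) W' ∧ ∀ A, W' A ≠ 0 → m ≤ (F ∩ A).card := by
    intro T
    induction T using Finset.induction_on with
    | empty => intro _; exact ⟨W, by simpa using H, hb⟩
    | insert i T hi ih =>
      intro hd
      rw [Finset.disjoint_insert_right] at hd
      obtain ⟨W', h1, h2⟩ := ih hd.2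
      refine ⟨_, by rw [Finset.union_insert]; exact h1.step i (by simp [hd.1, hi]), ?_⟩
      intro A hA
      have := h2 (A.erase i) (fun h => hA (by simp [h]))
      refine this.trans (Finset.card_le_card ?_)
      exact Finset.inter_subset_inter (le_refl _) (Finset.erase_subset _ _)
  have := main (S \ F) Finset.disjoint_sdiff
  rwa [Finset.union_sdiff_of_subset hFS] at this

theorem coin_empty : Coin ∅ (fun A => one (A = ∅)) := by
  refine ⟨fun A => one_nonneg _, by simp [one], by simp, by simp⟩

theorem coin_odd (F : Finset ℕ) (k : ℕ) (hF : F.card = 2 * k + 1) :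
    ∃ W, Coin F W ∧ ∀ A, W A ≠ 0 → k ≤ (F ∩ A).card := by
  set C : ℝ := ((2 * k + 1).choose k : ℝ) with hC
  have hCpos : 0 < C := by
    have := Nat.choose_pos (show k ≤ 2 * k + 1 by omega)
    rw [hC]; positivity
  set W : Finset ℕ → ℝ := fun A => 1 / (2 * k + 2) * one (A = F)
    + (2 * k + 1) / (2 * k + 2) / C * one (A ∈ powersetCard k F) with hW
  have key : ∀ P : Finset ℕ → Prop, P F → ∑ A ∈ F.powerset, W A * one (P A) =
      1 / (2 * k + 2) + (2 * k + 1) / (2 * k + 2) / C * (∑ A ∈ powersetCard k F, one (P A)) := by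
    intro P hP
    simp only [hW, add_mul, Finset.sum_add_distrib, mul_assoc]
    rw [← Finset.mul_sum, ← Finset.mul_sum]
    congr 1
    · rw [Finset.sum_eq_single F]
      · simp [one, hP]
      · intro A _ hA; simp [one, hA]
      · simp
    · congr 1
      refine (Finset.sum_subset_zero_on_sdiff ?_ ?_ ?_).symm
      · intro A hA; exact mem_powerset.2 (mem_powersetCard.1 hA).1
      · intro A hA; simp [one, (Finset.mem_sdiff.1 hA).2]
      · intro A hA; simp [one, hA]
  have cnt1 : ∀ i ∈ F, (2 * k + 1 : ℝ) * (∑ A ∈ powersetCard k F, one (i ∈ A)) = k * C := by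
    intro i hi
    have e : ∀ A : Finset ℕ, one (i ∈ A) = one ({i} ⊆ A) := by
      simp
    simp only [e]
    rw [sum_one_card]
    rcases k with _ | k
    · simp
    · rw [card_sup _ _ _ (by simpa using hi) (by simp), hF, hC]
      have := Nat.add_one_mul_choose_eq (2 * (k+1)) k
      simp only [card_singleton, Nat.add_sub_cancel] at this ⊢
      have h2 : (((2 * (k+1) + 1) * (2 * (k+1)).choose k : ℕ) : ℝ) = (((2 * (k+1) + 1).choose (k+1) * (k+1) : ℕ) : ℝ) := by
        exact_mod_cast this
      push_cast at h2 ⊢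
      linarith
  have cnt2 : ∀ i ∈ F, ∀ j ∈ F, i ≠ j →
      (2 * k + 1 : ℝ) * (2 * k) * (∑ A ∈ powersetCard k F, one (i ∈ A ∧ j ∈ A)) = k * (k - 1) * C := by
    intro i hi j hj hij
    have e : ∀ A : Finset ℕ, one (i ∈ A ∧ j ∈ A) = one ({i, j} ⊆ A) := by
      simp [Finset.insert_subset_iff]
    have hc2 : ({i, j} : Finset ℕ).card = 2 := Finset.card_pair hij
    simp only [e]
    rw [sum_one_card]
    rcases k with _ | _ | k
    · simp
    · have : (powersetCard 1 F).filter (fun A => {i, j} ⊆ A) = ∅ := by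
        refine Finset.filter_eq_empty_iff.2 fun A hA hs => ?_
        have := Finset.card_le_card hs
        rw [hc2, (mem_powersetCard.1 hA).2] at this
        omega
      simp [this]
    · rw [card_sup _ _ _ (by simp [Finset.insert_subset_iff, hi, hj]) (by omega), hF, hC, hc2]
      have h1 := Nat.add_one_mul_choose_eq (2 * (k+1+1)) (k+1)
      have h2 := Nat.add_one_mul_choose_eq (2 * (k+1)+1) k
      have e1 : 2 * (k+1+1) + 1 - 2 = 2 * (k+1) + 1 := by omega
      have e2 : 2 * (k+1) + 1 + 1 = 2 * (k+1+1) := by omega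
      have e3 : k + 1 + 1 - 2 = k := by omega
      rw [e2] at h2
      rw [e1, e3]
      have h1' : (((2 * (k+1+1) + 1) * (2 * (k+1+1)).choose (k+1) : ℕ) : ℝ)
        = (((2 * (k+1+1) + 1).choose (k+1+1) * (k+1+1) : ℕ) : ℝ) := by exact_mod_cast h1
      have h2' : (((2 * (k+1+1)) * (2 * (k+1)+1).choose k : ℕ) : ℝ)
        = (((2 * (k+1+1)).choose (k+1) * (k+1) : ℕ) : ℝ) := by exact_mod_cast h2
      push_cast at h1' h2' ⊢
      linear_combination (2 * ((k:ℝ)+1+1)+1) * h2' + ((k:ℝ)+1) * h1'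
  have hk2 : (2 * (k:ℝ) + 2) ≠ 0 := by positivity
  refine ⟨W, ⟨?_, ?_, ?_, ?_⟩, ?_⟩
  · intro A
    have h1 := one_nonneg (A = F)
    have h2 := one_nonneg (A ∈ powersetCard k F)
    simp only [hW]; positivity
  · have := key (fun _ => True) trivial
    simp only [one, if_true, mul_one] at this
    rw [this, Finset.sum_const, nsmul_eq_mul, mul_one, Finset.card_powersetCard, hF, ← hC]
    field_simp
    ring
  · intro i hi
    rw [key _ hi]
    have := cnt1 i hi
    generalize (∑ A ∈ powersetCard k F, one (i ∈ A)) = n at *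
    field_simp
    linear_combination this
  · intro i hi j hj hij
    rw [key _ ⟨hi, hj⟩]
    have := cnt2 i hi j hj hij
    have hk0 : (k : ℝ) ≠ 0 := by
      intro h0
      have : k = 0 := by exact_mod_cast h0
      have h1 := Finset.card_le_card (show ({i, j} : Finset ℕ) ⊆ F by simp [Finset.insert_subset_iff, hi, hj])
      rw [Finset.card_pair hij] at h1; omega
    generalize (∑ A ∈ powersetCard k F, one (i ∈ A ∧ j ∈ A)) = n at *
    have h2 : (2 * k + 1 : ℝ) * 2 * n = (k - 1) * C := by
      apply mul_left_cancel₀ hk0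
      linear_combination this
    field_simp
    linear_combination 2 * h2
  · intro A hA
    by_cases h1 : A = F
    · subst h1; simp; omega
    · by_cases h2 : A ∈ powersetCard k F
      · rw [Finset.inter_eq_right.2 (mem_powersetCard.1 h2).1, (mem_powersetCard.1 h2).2]
      · exact absurd (by simp only [hW, one, h1, h2, if_false]; ring) hA

theorem coin_exists (F S : Finset ℕ) (hFS : F ⊆ S) :
    ∃ W, Coin S W ∧ ∀ A, W A ≠ 0 → F.card ≤ 2 * (F ∩ A).card + 2 := by
  rcases Nat.even_or_odd' F.card with ⟨k, hk | hk⟩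
  · rcases k with _ | k
    · obtain ⟨W, h, _⟩ := coin_extend ∅ 0 _ coin_empty (by simp) S (by simp)
      exact ⟨W, h, fun A _ => by omega⟩
    · obtain ⟨x, hx⟩ : F.Nonempty := Finset.card_pos.1 (by omega)
      have hc := Finset.card_erase_of_mem hx
      obtain ⟨W, h1, h2⟩ := coin_odd (F.erase x) k (by omega)
      obtain ⟨W', h3, h4⟩ := coin_extend _ _ W h1 h2 S ((Finset.erase_subset _ _).trans hFS)
      refine ⟨W', h3, fun A hA => ?_⟩
      have := h4 A hA
      have h5 := Finset.card_le_card (Finset.inter_subset_inter (Finset.erase_subset x F) (le_refl A))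
      omega
  · obtain ⟨W, h1, h2⟩ := coin_odd F k hk
    obtain ⟨W', h3, h4⟩ := coin_extend _ _ W h1 h2 S hFS
    exact ⟨W', h3, fun A hA => by have := h4 A hA; omega⟩

noncomputable def hf (p : Prop) : ℝ := if p then 1/2 else 1

theorem one_and (p q : Prop) : one (p ∧ q) = one p * one q := by
  unfold one; by_cases hp : p <;> by_cases hq : q <;> simp [hp, hq]

theorem one_lin (p P : Prop) : ∃ α β : ℝ, (∀ X : Prop, one (p → (X ↔ P)) = α + β * one X) ∧ α + β / 2 = hf p := by
  by_cases hp : p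
  · by_cases hP : P
    · exact ⟨0, 1, by intro X; by_cases h : X <;> simp [one, hp, hP, h], by simp [hf, hp]⟩
    · exact ⟨1, -1, by intro X; by_cases h : X <;> simp [one, hp, hP, h], by norm_num [hf, hp]⟩
  · exact ⟨1, 0, by intro X; simp [one, hp], by simp [hf, hp]⟩

theorem Coin.e1 {S : Finset ℕ} {W : Finset ℕ → ℝ} (H : Coin S W) {i : ℕ} (hi : i ∈ S) (p P : Prop) :
    ∑ A ∈ S.powerset, W A * one (p → (i ∈ A ↔ P)) = hf p := by
  obtain ⟨a, b, h1, h2⟩ := one_lin p P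
  have : ∀ A, W A * one (p → (i ∈ A ↔ P)) = a * W A + b * (W A * one (i ∈ A)) := by
    intro A; rw [h1]; ring
  simp only [this, Finset.sum_add_distrib, ← Finset.mul_sum, H.tot, H.m1 i hi]
  rw [← h2]; ring

theorem Coin.e2 {S : Finset ℕ} {W : Finset ℕ → ℝ} (H : Coin S W) {i j : ℕ} (hi : i ∈ S) (hj : j ∈ S)
    (hij : i ≠ j) (p P q Q : Prop) :
    ∑ A ∈ S.powerset, W A * (one (p → (i ∈ A ↔ P)) * one (q → (j ∈ A ↔ Q))) = hf p * hf q := by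
  obtain ⟨a, b, h1, h2⟩ := one_lin p P
  obtain ⟨c, d, h3, h4⟩ := one_lin q Q
  have : ∀ A, W A * (one (p → (i ∈ A ↔ P)) * one (q → (j ∈ A ↔ Q))) =
      a * c * W A + b * c * (W A * one (i ∈ A)) + a * d * (W A * one (j ∈ A))
      + b * d * (W A * one (i ∈ A ∧ j ∈ A)) := by
    intro A; rw [h1, h3, one_and]; ring
  simp only [this, Finset.sum_add_distrib, ← Finset.mul_sum, H.tot, H.m1 i hi, H.m1 j hj, H.m2 i hi j hj hij]
  rw [← h2, ← h4]; ring

theorem psi_hf (n : ℕ) : psi n = 2 * (one (n ≠ 0 ∧ n ≤ 4) * hf (n ≠ 2) * hf (n ≠ 1)) := by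
  by_cases h : n ≤ 4
  · interval_cases n <;> norm_num [psi, psi2, one, hf]
  · have h1 : n ≠ 1 := by omega
    have h2 : n ≠ 2 := by omega
    have h3 : n ≠ 3 := by omega
    have h4 : n ≠ 4 := by omega
    simp [psi, psi2, one, h, h1, h2, h3, h4]

noncomputable def lab (A : Finset ℕ) (i : ℕ) : Fin 2 := if i ∈ A then 1 else 0

def cI (n i : ℕ) : ℕ := if n = 4 then i else i + 1

def sg (H : ℕ → Fin 2 → ℕ → Fin 2 → Prop) (s : ℕ → ℕ) (A : Finset ℕ) (i : ℕ) (a : Fin 2) : Prop :=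
  s i = 3 ∨ (s i = 2 ∧ (a = 0 ∨ H i 0 i 1)) ∨ (s i = 4 ∧ s (i-1) = 3 ∧ H (i-1) (lab A (i-1)) i (lab A i))

def mem (H : ℕ → Fin 2 → ℕ → Fin 2 → Prop) (s : ℕ → ℕ) (A B : Finset ℕ) (i : ℕ) (a : Fin 2) : Prop :=
  (s i ≠ 0 ∧ s i ≤ 4) ∧ (s i ≠ 2 → (i ∈ A ↔ a = 1)) ∧ (s i ≠ 1 → (cI (s i) i ∈ B ↔ sg H s A i a))

theorem lab_eq {A : Finset ℕ} {i : ℕ} {a : Fin 2} (h : i ∈ A ↔ a = 1) : lab A i = a := by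
  unfold lab
  split_ifs with h1
  · exact (h.1 h1).symm
  · have : a ≠ 1 := fun h2 => h1 (h.2 h2)
    omega

section mom
variable {H : ℕ → Fin 2 → ℕ → Fin 2 → Prop} {s : ℕ → ℕ} {n : ℕ} {W0 W : Finset ℕ → ℝ}

theorem mom_far (h0 : Coin (range (n+1)) W0) (h1 : Coin (range (n+1)) W) (i j : ℕ) (a b : Fin 2)
    (hij : i + 2 ≤ j) (hj : j < n) :
    ∑ A ∈ (range (n+1)).powerset, ∑ B ∈ (range (n+1)).powerset,
      W0 A * W B * one (mem H s A B i a ∧ mem H s A B j b) = 1/4 * (psi (s i) * psi (s j)) := by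
  have hci : cI (s i) i ≤ i + 1 := by unfold cI; split_ifs <;> omega
  have hcj : j ≤ cI (s j) j := by unfold cI; split_ifs <;> omega
  have hcj' : cI (s j) j ≤ j + 1 := by unfold cI; split_ifs <;> omega
  have key : ∀ A B, W0 A * W B * one (mem H s A B i a ∧ mem H s A B j b) =
     (one (s i ≠ 0 ∧ s i ≤ 4) * one (s j ≠ 0 ∧ s j ≤ 4)) *
     ((W0 A * (one (s i ≠ 2 → (i ∈ A ↔ a = 1)) * one (s j ≠ 2 → (j ∈ A ↔ b = 1)))) *
      (W B * (one (s i ≠ 1 → (cI (s i) i ∈ B ↔ sg H s A i a)) * one (s j ≠ 1 → (cI (s j) j ∈ B ↔ sg H s A j b))))) := by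
    intro A B
    unfold mem
    simp only [one_and]
    ring
  simp only [key, ← Finset.mul_sum]
  have inner : ∀ A, ∑ B ∈ (range (n+1)).powerset, 
      (W B * (one (s i ≠ 1 → (cI (s i) i ∈ B ↔ sg H s A i a)) * one (s j ≠ 1 → (cI (s j) j ∈ B ↔ sg H s A j b))))
      = hf (s i ≠ 1) * hf (s j ≠ 1) := fun A =>
    h1.e2 (Finset.mem_range.2 (by omega)) (Finset.mem_range.2 (by omega)) (by omega) _ _ _ _
  simp only [inner, ← Finset.sum_mul]
  rw [h0.e2 (Finset.mem_range.2 (by omega)) (Finset.mem_range.2 (by omega)) (by omega), psi_hf, psi_hf]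
  ring

theorem mom_near (h0 : Coin (range (n+1)) W0) (h1 : Coin (range (n+1)) W) (i : ℕ) (a b : Fin 2)
    (hj : i + 1 < n) (hv : s i ≠ 0 → s (i+1) ≠ 0 → s i = 3 ∧ s (i+1) = 4) (hH : H i a (i+1) b) :
    ∑ A ∈ (range (n+1)).powerset, ∑ B ∈ (range (n+1)).powerset,
      W0 A * W B * one (mem H s A B i a ∧ mem H s A B (i+1) b) = 1/8 * (one (s i = 3) * one (s (i+1) = 4)) := by
  by_cases hs : s i = 3 ∧ s (i+1) = 4
  · have key : ∀ A B, W0 A * W B * one (mem H s A B i a ∧ mem H s A B (i+1) b) =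
     (W0 A * (one (True → (i ∈ A ↔ a = 1)) * one (True → (i + 1 ∈ A ↔ b = 1)))) *
      (W B * one (True → (i + 1 ∈ B ↔ True))) := by
      intro A B
      have : (mem H s A B i a ∧ mem H s A B (i+1) b) ↔
          (((True → (i ∈ A ↔ a = 1)) ∧ (True → (i + 1 ∈ A ↔ b = 1))) ∧ (True → (i + 1 ∈ B ↔ True))) := by
        unfold mem sg cI
        simp only [hs.1, hs.2, Nat.add_sub_cancel]
        constructor
        · rintro ⟨⟨_, h2, h3⟩, ⟨_, h4, _⟩⟩
          refine ⟨⟨fun _ => h2 (by norm_num), fun _ => h4 (by norm_num)⟩, fun _ => ?_⟩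
          simpa using h3
        · rintro ⟨⟨h2, h3⟩, h4⟩
          have e1 := lab_eq (h2 trivial)
          have e2 := lab_eq (h3 trivial)
          simp only [e1, e2]
          simp [h2 trivial, h3 trivial, h4 trivial, hH]
      rw [this, one_and, one_and]; ring
    simp only [key, ← Finset.mul_sum]
    rw [h1.e1 (Finset.mem_range.2 (by omega)), ← Finset.sum_mul,
      h0.e2 (Finset.mem_range.2 (by omega)) (Finset.mem_range.2 (by omega)) (by omega)]
    norm_num [hf, one, hs.1, hs.2]
  · have h2 : ∀ A B, one (mem H s A B i a ∧ mem H s A B (i+1) b) = 0 := by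
      intro A B
      unfold one
      rw [if_neg]
      rintro ⟨h3, h4⟩
      exact hs (hv h3.1.1 h4.1.1)
    have h3 : one (s i = 3) * one (s (i+1) = 4) = 0 := by
      rw [← one_and]; simp [one, hs]
    simp [h2, h3]

theorem mom_same (h0 : Coin (range (n+1)) W0) (h1 : Coin (range (n+1)) W) (i : ℕ)
    (hj : i < n) (hH : H i 0 i 1) :
    ∑ A ∈ (range (n+1)).powerset, ∑ B ∈ (range (n+1)).powerset,
      W0 A * W B * one (mem H s A B i 0 ∧ mem H s A B i 1) = 1/2 * one (s i = 2) := by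
  by_cases hs : s i = 2
  · have key : ∀ A B, W0 A * W B * one (mem H s A B i 0 ∧ mem H s A B i 1) =
     W0 A * (W B * one (True → (i + 1 ∈ B ↔ True))) := by
      intro A B
      have : (mem H s A B i 0 ∧ mem H s A B i 1) ↔ (True → (i + 1 ∈ B ↔ True)) := by
        unfold mem sg cI
        simp [hs, hH]
      rw [this]; ring
    simp only [key, ← Finset.mul_sum]
    rw [h1.e1 (Finset.mem_range.2 (by omega)), ← Finset.sum_mul, h0.tot]
    norm_num [hf, one, hs]
  · have h2 : ∀ A B, one (mem H s A B i 0 ∧ mem H s A B i 1) = 0 := by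
      intro A B
      unfold one
      rw [if_neg]
      rintro ⟨h3, h4⟩
      have h5 := h3.2.1 hs
      have h6 := h4.2.1 hs
      simp at h5 h6
      exact h5 h6
    simp only [h2]; simp [hs, one]
end mom

theorem mem_clique {V : Type*} (G : SimpleGraph V) (idx : V → ℕ) (sd : V → Fin 2)
    (hinj : ∀ u v, idx u = idx v → sd u = sd v → u = v)
    (hfar : ∀ u v, idx u + 2 ≤ idx v → G.Adj u v) (s : ℕ → ℕ) (A B : Finset ℕ) (n : ℕ) (hlt : ∀ v, idx v < n)
    (hv : ∀ i, i + 1 < n → s i ≠ 0 → s (i+1) ≠ 0 → s i = 3 ∧ s (i+1) = 4)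
    (H : ℕ → Fin 2 → ℕ → Fin 2 → Prop)
    (hH : ∀ i a j b, H i a j b ↔ ∃ u v, idx u = i ∧ sd u = a ∧ idx v = j ∧ sd v = b ∧ G.Adj u v)
    (u v : V) (hu : mem H s A B (idx u) (sd u)) (hvv : mem H s A B (idx v) (sd v)) (huv : u ≠ v)
    (hle : idx u ≤ idx v) : G.Adj u v := by
  have back : H (idx u) (sd u) (idx v) (sd v) → G.Adj u v := by
    intro h
    obtain ⟨u', v', h1, h2, h3, h4, h5⟩ := (hH _ _ _ _).1 h
    rwa [hinj u' u h1 h2, hinj v' v h3 h4] at h5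
  obtain h | h | h : idx u + 2 ≤ idx v ∨ idx v = idx u + 1 ∨ idx v = idx u := by omega
  · exact hfar u v h
  · have hs := hv (idx u) (h ▸ hlt v) hu.1.1 (h ▸ hvv.1.1)
    rw [← h] at hs
    have l1 := lab_eq (hu.2.1 (by omega))
    have l2 := lab_eq (hvv.2.1 (by omega))
    have c1 := hu.2.2 (by omega)
    have c2 := hvv.2.2 (by omega)
    have e : idx v - 1 = idx u := by omega
    simp only [sg, cI, hs.1, hs.2, e, l1, l2] at c1 c2
    simp [← h] at c1 c2
    exact back (c2.1 c1)
  · have hsd : sd u ≠ sd v := fun h' => huv (hinj u v h.symm h')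
    have h2 : s (idx u) = 2 := by
      by_contra h2
      have l1 := lab_eq (hu.2.1 h2)
      have l2 := lab_eq (hvv.2.1 (by rwa [h]))
      rw [h] at l2
      exact hsd (l1.symm.trans l2)
    have c1 := hu.2.2 (by omega)
    have c2 := hvv.2.2 (by rw [h]; omega)
    rw [h] at c2
    simp only [sg, cI, h2] at c1 c2
    simp at c1 c2
    rw [c1] at c2
    have h01 : H (idx u) 0 (idx u) 1 := by
      by_contra hn
      simp only [hn, or_false] at c2
      omega
    rw [h] at back
    obtain h3 | h3 : (sd u = 0 ∧ sd v = 1) ∨ (sd u = 1 ∧ sd v = 0) := by omega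
    · rw [h3.1, h3.2] at back; exact back h01
    · obtain ⟨u', v', g1, g2, g3, g4, g5⟩ := (hH _ _ _ _).1 h01
      rw [hinj u' v (g1.trans h.symm) (g2.trans h3.2.symm), hinj v' u g3 (g4.trans h3.1.symm)] at g5
      exact g5.symm

theorem mem_size {V : Type*} [Fintype V] (idx : V → ℕ) (sd : V → Fin 2) (n r : ℕ)
    (hsurj : ∀ i < n, ∀ a, ∃ v, idx v = i ∧ sd v = a) (hn : 8 * (r + 1) ≤ n)
    (s : ℕ → ℕ) (A B : Finset ℕ) (H : ℕ → Fin 2 → ℕ → Fin 2 → Prop)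
    (hsc : ∀ k < r + 1, 2 ≤ ∑ p ∈ range 8, sc (s (8 * k + p)))
    (hB : (((range (8 * (r+1))).filter (fun i => s i = 2 ∨ s i = 3)).image (· + 1)).card ≤
      2 * ((((range (8 * (r+1))).filter (fun i => s i = 2 ∨ s i = 3)).image (· + 1)) ∩ B).card + 2) :
    r ≤ (univ.filter (fun v => mem H s A B (idx v) (sd v))).card := by
  set R := range (8 * (r+1)) with hR
  set F := R.filter (fun i => s i = 2 ∨ s i = 3) with hF
  have hinj : Function.Injective (fun i : ℕ => i + 1) := fun a b h => by simpa using h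
  have hFB : (F.image (· + 1)) ∩ B = (F.filter (fun i => i + 1 ∈ B)).image (· + 1) := by
    ext x
    simp only [Finset.mem_inter, Finset.mem_image, Finset.mem_filter]
    constructor
    · rintro ⟨⟨i, hi, rfl⟩, hb⟩; exact ⟨i, ⟨hi, hb⟩, rfl⟩
    · rintro ⟨i, ⟨hi, hb⟩, rfl⟩; exact ⟨⟨i, hi, rfl⟩, hb⟩
  rw [hFB, Finset.card_image_of_injective _ hinj, Finset.card_image_of_injective _ hinj] at hB
  have tot : ∀ m, ∑ i ∈ range (8 * m), sc (s i) = ∑ k ∈ range m, ∑ p ∈ range 8, sc (s (8 * k + p)) := by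
    intro m
    induction m with
    | zero => simp
    | succ m ih => rw [Finset.sum_range_succ, ← ih, Nat.mul_succ, Finset.sum_range_add]
  have h1 : 2 * (r + 1) ≤ ∑ i ∈ R, sc (s i) := by
    rw [hR, tot]
    calc 2 * (r+1) = ∑ k ∈ range (r+1), 2 := by simp [mul_comm]
      _ ≤ _ := Finset.sum_le_sum fun k hk => hsc k (Finset.mem_range.1 hk)
  have h2 : ∑ i ∈ R, sc (s i) = 2 * (R.filter (fun i => s i = 1)).card + F.card := by
    rw [hF, Finset.card_filter, Finset.card_filter, Finset.mul_sum, ← Finset.sum_add_distrib]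
    refine Finset.sum_congr rfl fun i _ => ?_
    unfold sc
    split_ifs <;> omega
  have h3 : (R.filter (fun i => s i = 1)).card + (F.filter (fun i => i + 1 ∈ B)).card ≤
      (univ.filter (fun v => mem H s A B (idx v) (sd v))).card := by
    rw [← Finset.card_union_of_disjoint]
    · refine le_trans (Finset.card_le_card (t := (univ.filter (fun v => mem H s A B (idx v) (sd v))).image idx) ?_)
        Finset.card_image_le
      intro i hi
      simp only [Finset.mem_union, Finset.mem_filter, hF] at hi
      have hiR : i < n := by
        have : i ∈ R := by rcases hi with h | h; exacts [h.1, h.1.1]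
        rw [hR, Finset.mem_range] at this
        omega
      rcases hi with h | ⟨⟨_, h | h⟩, hb⟩
      · obtain ⟨v, hv1, hv2⟩ := hsurj i hiR (lab A i)
        refine Finset.mem_image.2 ⟨v, Finset.mem_filter.2 ⟨Finset.mem_univ _, ?_⟩, hv1⟩
        rw [hv1, hv2]
        refine ⟨by omega, fun _ => ?_, fun h' => absurd h.2 h'⟩
        unfold lab; split_ifs with hA <;> simp [hA]
      · obtain ⟨v, hv1, hv2⟩ := hsurj i hiR 0
        refine Finset.mem_image.2 ⟨v, Finset.mem_filter.2 ⟨Finset.mem_univ _, ?_⟩, hv1⟩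
        rw [hv1, hv2]
        refine ⟨by omega, fun h' => absurd h h', fun _ => ?_⟩
        simp [sg, cI, h, hb]
      · obtain ⟨v, hv1, hv2⟩ := hsurj i hiR (lab A i)
        refine Finset.mem_image.2 ⟨v, Finset.mem_filter.2 ⟨Finset.mem_univ _, ?_⟩, hv1⟩
        rw [hv1, hv2]
        refine ⟨by omega, fun _ => ?_, fun _ => ?_⟩
        · unfold lab; split_ifs with hA <;> simp [hA]
        · simp [sg, cI, h, hb]
    · rw [Finset.disjoint_left]
      intro i h h'
      simp only [Finset.mem_filter, hF] at h h'
      omega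
  omega

theorem main {V : Type*} [Fintype V] (G : SimpleGraph V) (idx : V → ℕ) (sd : V → Fin 2) (n r : ℕ) (hr : 3 ≤ r)
    (hinj : ∀ u v, idx u = idx v → sd u = sd v → u = v)
    (hfar : ∀ u v, idx u + 2 ≤ idx v → G.Adj u v) (hlt : ∀ v, idx v < n)
    (hsurj : ∀ i < n, ∀ a, ∃ v, idx v = i ∧ sd v = a) (hn : 8 * (r + 1) ≤ n) : fracCliqueDecomp G r := by
  obtain ⟨Ω, _, w, st, Y, HF⟩ := fam_exists n
  have hsub : ∀ ω, (((range (8 * (r+1))).filter (fun i => st ω i = 2 ∨ st ω i = 3)).image (· + 1)) ⊆ range (n+1) := by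
    intro ω x hx
    simp only [Finset.mem_image, Finset.mem_filter, Finset.mem_range] at hx ⊢
    obtain ⟨i, hi, rfl⟩ := hx
    omega
  choose W hW hWb using fun ω => coin_exists _ _ (hsub ω)
  obtain ⟨W0, hW0, _⟩ := coin_exists ∅ (range (n+1)) (by simp)
  set H : ℕ → Fin 2 → ℕ → Fin 2 → Prop :=
    fun i a j b => ∃ u v, idx u = i ∧ sd u = a ∧ idx v = j ∧ sd v = b ∧ G.Adj u v with hHdef
  set P := (range (n+1)).powerset with hP
  refine spread G r (by omega) (univ ×ˢ (P ×ˢ P)) (fun x : Ω × Finset ℕ × Finset ℕ => w x.1 * (W0 x.2.1 * W x.1 x.2.2))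
    (fun x => univ.filter (fun v => mem H (st x.1) x.2.1 x.2.2 (idx v) (sd v))) (1/64) (by norm_num) ?_ ?_ ?_
  · intro x
    exact mul_nonneg (HF.w0 _) (mul_nonneg (hW0.nn _) ((hW _).nn _))
  · rintro ⟨ω, A, B⟩ hx
    have hw : w ω ≠ 0 := left_ne_zero_of_mul hx
    have hb : W ω B ≠ 0 := right_ne_zero_of_mul (right_ne_zero_of_mul hx)
    constructor
    · intro u hu v hv huv
      simp only [coe_filter, Set.mem_ofPred_eq, Finset.mem_univ, true_and] at hu hv
      have hval : ∀ i, i + 1 < n → st ω i ≠ 0 → st ω (i+1) ≠ 0 → st ω i = 3 ∧ st ω (i+1) = 4 :=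
        fun i hi => HF.valid ω hw i (by omega)
      rcases le_total (idx u) (idx v) with h | h
      · exact mem_clique G idx sd hinj hfar (st ω) A B n hlt hval H (fun _ _ _ _ => Iff.rfl) u v hu hv huv h
      · exact (mem_clique G idx sd hinj hfar (st ω) A B n hlt hval H (fun _ _ _ _ => Iff.rfl) v u hv hu huv.symm h).symm
    · exact mem_size idx sd n r hsurj hn (st ω) A B H (fun k hk => HF.score ω k (by omega)) (hWb ω B hb)
  · have expand : ∀ u v, ∑ x ∈ (univ : Finset Ω) ×ˢ (P ×ˢ P), (w x.1 * (W0 x.2.1 * W x.1 x.2.2)) *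
        one (u ∈ univ.filter (fun v => mem H (st x.1) x.2.1 x.2.2 (idx v) (sd v)) ∧
          v ∈ univ.filter (fun v => mem H (st x.1) x.2.1 x.2.2 (idx v) (sd v)))
        = ∑ ω, w ω * ∑ A ∈ P, ∑ B ∈ P, W0 A * W ω B *
          one (mem H (st ω) A B (idx u) (sd u) ∧ mem H (st ω) A B (idx v) (sd v)) := by
      intro u v
      rw [Finset.sum_product]
      refine Finset.sum_congr rfl fun ω _ => ?_
      rw [Finset.sum_product, Finset.mul_sum]
      refine Finset.sum_congr rfl fun A _ => ?_
      rw [Finset.mul_sum]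
      refine Finset.sum_congr rfl fun B _ => ?_
      simp only [Finset.mem_filter, Finset.mem_univ, true_and]
      ring
    have main : ∀ u v, G.Adj u v → idx u ≤ idx v → (idx u = idx v → sd u = 0) →
        ∑ ω, w ω * ∑ A ∈ P, ∑ B ∈ P, W0 A * W ω B *
          one (mem H (st ω) A B (idx u) (sd u) ∧ mem H (st ω) A B (idx v) (sd v)) = 1/64 := by
      intro u v huv hle hs
      have hHuv : H (idx u) (sd u) (idx v) (sd v) := ⟨u, v, rfl, rfl, rfl, rfl, huv⟩
      have hvn := hlt v
      obtain h | h | h : idx u + 2 ≤ idx v ∨ idx v = idx u + 1 ∨ idx v = idx u := by omega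
      · rw [Finset.sum_congr rfl (g := fun ω => 1/4 * (w ω * (psi (st ω (idx u)) * psi (st ω (idx v)))))
          (fun ω _ => by rw [mom_far hW0 (hW ω) (idx u) (idx v) (sd u) (sd v) h hvn]; ring),
          ← Finset.mul_sum, HF.pair (idx u) (idx v) h (by omega)]
        norm_num
      · rw [h] at hHuv hvn ⊢
        rw [Finset.sum_congr rfl (g := fun ω => 1/8 * (w ω * (one (st ω (idx u) = 3) * one (st ω (idx u + 1) = 4))))
          (fun ω _ => by
            by_cases hw : w ω = 0
            · simp [hw]
            · rw [mom_near hW0 (hW ω) (idx u) (sd u) (sd v) hvn (HF.valid ω hw _ (by omega)) hHuv]; ring),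
          ← Finset.mul_sum, HF.b (idx u) (by omega)]
        norm_num
      · have hu0 := hs h.symm
        have hv1 : sd v = 1 := by
          by_contra h1
          exact huv.ne (hinj u v h.symm (by omega))
        rw [h, hu0, hv1] at hHuv
        rw [h] at hvn ⊢
        rw [hu0, hv1]
        rw [Finset.sum_congr rfl (g := fun ω => 1/2 * (w ω * one (st ω (idx u) = 2)))
          (fun ω _ => by rw [mom_same hW0 (hW ω) (idx u) hvn hHuv]; ring),
          ← Finset.mul_sum, HF.ws (idx u) (by omega)]
        norm_num
    intro u v huv
    rw [expand]
    rcases lt_trichotomy (idx u) (idx v) with h | h | h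
    · exact main u v huv h.le (by omega)
    · by_cases h0 : sd u = 0
      · exact main u v huv h.le (fun _ => h0)
      · have h1 : sd v = 0 := by
          by_contra h1
          exact huv.ne (hinj u v h (by omega))
        have := main v u huv.symm h.ge (fun _ => h1)
        simpa only [and_comm] using this
    · have := main v u huv.symm h.le (by omega)
      simpa only [and_comm] using this

end FD

theorem stmt12 {V : Type*} [Fintype V] (G : SimpleGraph V) (r ℓ : ℕ)
    (hr : 3 ≤ r) (hℓ : 9 * r + 8 ≤ 2 * ℓ) (hcard : Fintype.card V = 4 * ℓ)
    (f : Fin (2 * ℓ) × Fin 2 → V) (hf : Function.Bijective f)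
    (hadj : ∀ u v, (Mgraph (2 * ℓ)).Adj u v → G.Adj (f u) (f v)) :
    fracCliqueDecomp G r := by
  set e := Equiv.ofBijective f hf with he
  have hfe : ∀ v, f (e.symm v) = v := fun v => e.apply_symm_apply v
  refine FD.main G (fun v => ((e.symm v).1 : ℕ)) (fun v => (e.symm v).2) (2 * ℓ) r hr ?_ ?_ ?_ ?_ (by omega)
  · intro u v h1 h2
    exact e.symm.injective (Prod.ext (Fin.ext h1) h2)
  · intro u v h
    have := hadj (e.symm u) (e.symm v) ?_
    · rwa [hfe, hfe] at this
    · rw [Mgraph, SimpleGraph.fromRel_adj]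
      refine ⟨fun h' => ?_, Or.inl ?_⟩
      · rw [h'] at h; omega
      · rw [abs_sub_comm]
        refine le_trans ?_ (le_abs_self _)
        omega
  · intro v; exact (e.symm v).1.2
  · intro i hi a
    exact ⟨e (⟨i, hi⟩, a), by simp, by simp⟩
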